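/- arXiv:2602.13686 — 2 statements merged into one kernel-verified Lean document; each statement's English description precedes it below -/
import Mathlib

section
/- The number 2n is the smallest positive integer m such that (S^j G)^m = Iₙ for every j = 0, 1, …, n−1; that is, (S^j G)^{2n} = Iₙ for all j ∈ {0, 1, …, n−1}, and for every positive integer m < 2n there exists some j ∈ {0, 1, …, n−1} with (S^j G)^m ≠ Iₙ. -/
open Matrix
open scoped MatrixGroups Pointwise

/-- The Grover matrix of degree `n`: every entry is `2/n`, except diagonal entries `2/n - 1`. -/
noncomputable def grover (n : ℕ) : Matrix (Fin n) (Fin n) ℂ :=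
  Matrix.of fun i j => if i = j then 2 / n - 1 else 2 / n

/-- The diagonal matrix `S = diag(1, ω, ω², …, ω^{n-1})` with `ω = exp(2πi/n)`. -/
noncomputable def sdiag (n : ℕ) : Matrix (Fin n) (Fin n) ℂ :=
  Matrix.diagonal fun j => Complex.exp (2 * Real.pi * Complex.I / n) ^ (j : ℕ)

/-- The vector `S ^ k (1, …, 1)`, that is `(1, ω ^ k, ω ^ (2 * k), …)`. -/
noncomputable def fourierVec (n k : ℕ) : Fin n → ℂ :=
  fun i => (Complex.exp (2 * Real.pi * Complex.I / n) ^ (i : ℕ)) ^ k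

lemma sdiag_pow_mulVec_fourierVec (n j k : ℕ) :
    sdiag n ^ j *ᵥ fourierVec n k = fourierVec n (k + j) := by
  ext i
  rw [sdiag, diagonal_pow, mulVec_diagonal]
  simp only [fourierVec, Pi.pow_apply]
  ring

lemma grover_mulVec {n : ℕ} (v : Fin n → ℂ) :
    grover n *ᵥ v = (2 / n * ∑ i, v i) • (1 : Fin n → ℂ) - v := by
  have h : grover n = (of fun _ _ => (2 / n : ℂ)) - 1 := by
    ext i j
    by_cases hij : i = j <;> simp [grover, hij, one_apply]
  rw [h, sub_mulVec, one_mulVec]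
  ext i
  simp [mulVec, dotProduct, Finset.mul_sum]

lemma grover_mulVec_fourierVec_of_dvd {n k : ℕ} (hn : n ≠ 0) (hk : n ∣ k) :
    grover n *ᵥ fourierVec n k = fourierVec n k := by
  have hω := Complex.isPrimitiveRoot_exp n hn
  have h1 : fourierVec n k = 1 := by
    ext i
    simp [fourierVec, pow_right_comm _ (i : ℕ) k, (hω.pow_eq_one_iff_dvd k).2 hk]
  have hn' : (n : ℂ) ≠ 0 := Nat.cast_ne_zero.2 hn
  rw [grover_mulVec, h1]
  ext i
  simp [hn']
  norm_num

lemma grover_mulVec_fourierVec_of_not_dvd {n k : ℕ} (hn : n ≠ 0) (hk : ¬ n ∣ k) :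
    grover n *ᵥ fourierVec n k = -fourierVec n k := by
  have hω := Complex.isPrimitiveRoot_exp n hn
  have hne := mt (hω.pow_eq_one_iff_dvd k).1 hk
  have h0 : ∑ i, fourierVec n k i = 0 := by
    simp only [fourierVec, pow_right_comm _ _ k]
    rw [Fin.sum_univ_eq_sum_range, geom_sum_eq hne, pow_right_comm, hω.pow_eq_one]
    simp
  rw [grover_mulVec, h0]
  simp

lemma exists_sign_pow_mulVec_fourierVec {n : ℕ} (hn : n ≠ 0) (j k m : ℕ) :
    ∃ s : ℂ, s ^ 2 = 1 ∧
      (sdiag n ^ j * grover n) ^ m *ᵥ fourierVec n k = s • fourierVec n (k + j * m) := by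
  induction m with
  | zero => exact ⟨1, by simp, by simp⟩
  | succ m ih =>
    obtain ⟨s, hs, h⟩ := ih
    rw [pow_succ', ← mulVec_mulVec, h, mulVec_smul, ← mulVec_mulVec, Nat.mul_succ, ← add_assoc]
    by_cases hd : n ∣ k + j * m
    · exact ⟨s, hs, by
        rw [grover_mulVec_fourierVec_of_dvd hn hd, sdiag_pow_mulVec_fourierVec]⟩
    · exact ⟨-s, by simpa using hs, by
        rw [grover_mulVec_fourierVec_of_not_dvd hn hd, mulVec_neg, sdiag_pow_mulVec_fourierVec,
          smul_neg, neg_smul]⟩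

lemma fourierVec_add_mul {n : ℕ} (hn : n ≠ 0) (k j : ℕ) :
    fourierVec n (k + j * n) = fourierVec n k := by
  have hω := Complex.isPrimitiveRoot_exp n hn
  ext i
  have h : (Complex.exp (2 * Real.pi * Complex.I / n) ^ (i : ℕ)) ^ (j * n) = 1 := by
    rw [← pow_mul, ← mul_assoc, pow_mul', hω.pow_eq_one, one_pow]
  simp [fourierVec, pow_add, h]

lemma dvd_of_fourierVec_eq_smul {n k : ℕ} (hn : 2 ≤ n) {s : ℂ}
    (h : fourierVec n 0 = s • fourierVec n k) : s = 1 ∧ n ∣ k := by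
  have hω := Complex.isPrimitiveRoot_exp n (by lia)
  have hs : s = 1 := by
    have := congrFun h ⟨0, by lia⟩
    simpa [fourierVec] using this.symm
  refine ⟨hs, (hω.pow_eq_one_iff_dvd k).1 ?_⟩
  have := congrFun h ⟨1, by lia⟩
  simpa [fourierVec, hs] using this.symm

lemma eq_one_of_mulVec_fourierVec {n : ℕ} (hn : n ≠ 0) {M : Matrix (Fin n) (Fin n) ℂ}
    (h : ∀ k, M *ᵥ fourierVec n k = fourierVec n k) : M = 1 := by
  have hω := Complex.isPrimitiveRoot_exp n hn
  set V := vandermonde fun i : Fin n => Complex.exp (2 * Real.pi * Complex.I / n) ^ (i : ℕ) with hV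
  have hdet : IsUnit V := by
    rw [isUnit_iff_isUnit_det, isUnit_iff_ne_zero, hV, det_vandermonde_ne_zero_iff]
    exact fun a b hab => Fin.ext (hω.pow_inj a.2 b.2 hab)
  refine hdet.mul_right_cancel ?_
  rw [one_mul]
  ext i k
  simpa [V, mul_apply, mulVec, dotProduct, fourierVec] using congrFun (h k) i

lemma sdiag_pow_mul_grover_pow_eq_one {n : ℕ} (hn : n ≠ 0) (j : ℕ) :
    (sdiag n ^ j * grover n) ^ (2 * n) = 1 := by
  refine eq_one_of_mulVec_fourierVec hn fun k => ?_
  obtain ⟨s, hs, h⟩ := exists_sign_pow_mulVec_fourierVec hn j k n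
  rw [fourierVec_add_mul hn] at h
  rw [two_mul, pow_add, ← mulVec_mulVec, h, mulVec_smul, h, smul_smul, ← sq, hs, one_smul]

lemma even_of_grover_pow_eq_one {n m : ℕ} (hn : 2 ≤ n) (h : grover n ^ m = 1) : Even m := by
  have key : ∀ t, grover n ^ t *ᵥ fourierVec n 1 = (-1 : ℂ) ^ t • fourierVec n 1 := by
    intro t
    induction t with
    | zero => simp
    | succ t ih =>
      rw [pow_succ', ← mulVec_mulVec, ih, mulVec_smul, grover_mulVec_fourierVec_of_not_dvd
        (by lia) (by rw [Nat.dvd_one]; lia), pow_succ, mul_neg_one, neg_smul, smul_neg]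
  have h1 := congrFun (key m) ⟨0, by lia⟩
  rw [h, one_mulVec] at h1
  exact neg_one_pow_eq_one_iff_even (by norm_num : (-1 : ℂ) ≠ 1) |>.1
    (by simpa [fourierVec] using h1.symm)

lemma sdiag_mul_grover_pow_succ_mulVec {n : ℕ} (hn : n ≠ 0) {t : ℕ} (ht : t < n) :
    (sdiag n * grover n) ^ (t + 1) *ᵥ fourierVec n 0 = (-1 : ℂ) ^ t • fourierVec n (t + 1) := by
  have hS (k : ℕ) := sdiag_pow_mulVec_fourierVec n 1 k
  simp only [pow_one] at hS
  induction t with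
  | zero =>
    rw [zero_add, pow_one, ← mulVec_mulVec, grover_mulVec_fourierVec_of_dvd hn (dvd_zero n), hS]
    simp
  | succ t ih =>
    rw [pow_succ', ← mulVec_mulVec, ih (by lia), mulVec_smul, ← mulVec_mulVec,
      grover_mulVec_fourierVec_of_not_dvd hn (Nat.not_dvd_of_pos_of_lt t.succ_pos ht), mulVec_neg,
      hS, pow_succ (-1 : ℂ) t, mul_neg_one, neg_smul, smul_neg]

/-- `2n` is the smallest positive integer `m` with `(S^j G)^m = Iₙ` for all `j = 0, …, n-1`. -/
theorem period_SjG (n : ℕ) (hn : 2 ≤ n) (G S : GL (Fin n) ℂ)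
    (hG : (G : Matrix (Fin n) (Fin n) ℂ) = grover n)
    (hS : (S : Matrix (Fin n) (Fin n) ℂ) = sdiag n) :
    (∀ j : ℕ, j ≤ n - 1 → (S ^ j * G) ^ (2 * n) = 1) ∧
      ∀ m : ℕ, 0 < m → m < 2 * n → ∃ j : ℕ, j ≤ n - 1 ∧ (S ^ j * G) ^ m ≠ 1 := by
  have hn0 : n ≠ 0 := by lia
  have hcoe (j m : ℕ) : (S ^ j * G) ^ m = 1 ↔ (sdiag n ^ j * grover n) ^ m = 1 := by
    rw [← hG, ← hS, Units.ext_iff]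
    simp
  simp only [ne_eq, hcoe]
  refine ⟨fun j _ => sdiag_pow_mul_grover_pow_eq_one hn0 j, fun m hm0 hm => ?_⟩
  by_contra! hall
  have heven : Even m := even_of_grover_pow_eq_one hn (by simpa using hall 0 (by lia))
  have h1 := hall 1 (by lia)
  have hdvd : n ∣ m := by
    obtain ⟨s, -, h⟩ := exists_sign_pow_mulVec_fourierVec hn0 1 0 m
    rw [h1, one_mulVec, zero_add, one_mul] at h
    exact (dvd_of_fourierVec_eq_smul hn h).2
  obtain ⟨c, rfl⟩ := hdvd
  obtain rfl : c = 1 := by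
    have : c < 2 := by nlinarith
    have : c ≠ 0 := by rintro rfl; simp at hm0
    lia
  rw [mul_one] at heven h1
  have h := sdiag_mul_grover_pow_succ_mulVec hn0 (t := n - 1) (by lia)
  rw [Nat.sub_add_cancel (by lia), ← pow_one (sdiag n), h1, one_mulVec] at h
  have hs := (dvd_of_fourierVec_eq_smul hn h).1
  rw [neg_one_pow_eq_one_iff_even (by norm_num)] at hs
  obtain ⟨a, ha⟩ := heven
  obtain ⟨b, hb⟩ := hs
  lia
end

section
/- The evolution matrix U of the Grover walk on the complete graph with n vertices (with a self-loop at each vertex) satisfies: 2n is the smallest positive integer m with U^m = I_{n²}. In particular the Grover walk is periodic with period 2n. -/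
open Matrix
open scoped MatrixGroups Pointwise

/-- The evolution matrix `U`: an `n² × n²` matrix in `n × n` blocks, whose `(r,c)`-th block is
`P_{(c-r) mod n}`, where `P_j` has `j`-th row equal to the `j`-th row of the Grover matrix
and all other rows zero. -/
noncomputable def evolU (n : ℕ) : Matrix (Fin n × Fin n) (Fin n × Fin n) ℂ :=
  Matrix.of fun p q => if p.2 = q.1 - p.1 then grover n p.2 q.2 else 0

/-- Action of the evolution matrix on a vector. -/
lemma evolU_mulVec {n : ℕ} [NeZero n] (f : Fin n × Fin n → ℂ) (r i : Fin n) :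
    (evolU n *ᵥ f) (r, i) = 2 / n * ∑ k, f (r + i, k) - f (r + i, i) := by
  have h (c : Fin n) : i = c - r ↔ c = r + i := by
    rw [eq_sub_iff_add_eq, eq_comm, add_comm]
  have hg (k : Fin n) : grover n i k = 2 / n - if i = k then 1 else 0 := by
    by_cases hik : i = k <;> simp [grover, hik]
  simp only [mulVec, dotProduct, evolU, of_apply, Fintype.sum_prod_type, h, hg, ite_mul, zero_mul]
  rw [Finset.sum_eq_single (r + i) (fun c _ hc => by simp [hc]) (by simp)]
  simp [sub_mul, Finset.mul_sum]

lemma pow_val_add {n : ℕ} [NeZero n] {z : ℂ} (hz : z ^ n = 1) (r i : Fin n) :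
    z ^ ((r + i : Fin n) : ℕ) = z ^ (r : ℕ) * z ^ (i : ℕ) := by
  rw [Fin.val_add, ← pow_eq_pow_mod _ hz, pow_add]

lemma inv_pow_mul_pow_pow_eq_one {n : ℕ} {z : ℂ} (hz : z ^ n = 1) (j i : ℕ) :
    (z⁻¹ ^ j * z ^ i) ^ n = 1 := by
  rw [mul_pow, pow_right_comm, pow_right_comm z, inv_pow z n, hz]
  simp

lemma sum_pow_val {n : ℕ} {w : ℂ} (hw : w ^ n = 1) :
    ∑ i : Fin n, w ^ (i : ℕ) = if w = 1 then (n : ℂ) else 0 := by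
  rw [Fin.sum_univ_eq_sum_range (fun i => w ^ i)]
  split_ifs with h
  · simp [h]
  · rw [geom_sum_eq h, hw, sub_self, zero_div]

/-- A character in the first coordinate times a function of the second one. -/
def charTensor {n : ℕ} (z : ℂ) (v : Fin n → ℂ) : Fin n × Fin n → ℂ :=
  fun p => z ^ (p.1 : ℕ) * v p.2

lemma evolU_mulVec_charTensor {n : ℕ} [NeZero n] {z : ℂ} (hz : z ^ n = 1) (v : Fin n → ℂ) :
    evolU n *ᵥ charTensor z v =
      charTensor z fun i => z ^ (i : ℕ) * (2 / n * ∑ k, v k - v i) := by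
  ext ⟨r, i⟩
  simp only [evolU_mulVec, charTensor, pow_val_add hz, ← Finset.mul_sum]
  ring

/-- The sign picked up in one step of the walk by the wave `z ^ (r + k * i)`. -/
noncomputable def waveSign (z : ℂ) (k : ℕ) : ℂ := if z ^ k = 1 then 1 else -1

lemma evolU_pow_mulVec_wave {n : ℕ} [NeZero n] {z : ℂ} (hz : z ^ n = 1) (k m : ℕ) :
    evolU n ^ m *ᵥ charTensor z (fun i => (z ^ k) ^ (i : ℕ)) =
      (∏ j ∈ Finset.range m, waveSign z (k + j)) •
        charTensor z (fun i => (z ^ (k + m)) ^ (i : ℕ)) := by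
  have hn : (n : ℂ) ≠ 0 := NeZero.ne _
  induction m with
  | zero => simp
  | succ m ih =>
    have hw : (z ^ (k + m)) ^ n = 1 := by rw [← pow_mul, mul_comm, pow_mul, hz, one_pow]
    rw [pow_succ', ← mulVec_mulVec, ih, mulVec_smul, evolU_mulVec_charTensor hz, sum_pow_val hw,
      Finset.prod_range_succ, mul_smul]
    congr 1
    ext ⟨r, i⟩
    simp only [charTensor, Pi.smul_apply, smul_eq_mul, waveSign, ← add_assoc, pow_succ z (k + m),
      mul_pow]
    split_ifs with h
    · rw [h]; field_simp; ring
    · ring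

lemma evolU_pow_mulVec_of_orthogonal {n : ℕ} [NeZero n] {z : ℂ} (hz : z ^ n = 1) {v : Fin n → ℂ}
    (hv : ∀ k : ℕ, ∑ i : Fin n, z ^ (k * i : ℕ) * v i = 0) (m : ℕ) :
    evolU n ^ m *ᵥ charTensor z v =
      charTensor z fun i => (-1) ^ m * (z ^ (m * i : ℕ) * v i) := by
  induction m with
  | zero => simp
  | succ m ih =>
    rw [pow_succ', ← mulVec_mulVec, ih, evolU_mulVec_charTensor hz, ← Finset.mul_sum, hv]
    congr 1
    ext i
    ring

lemma evolU_pow_two_mul_mulVec_wave {n : ℕ} [NeZero n] {z : ℂ} (hz : z ^ n = 1) (k : ℕ) :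
    evolU n ^ (2 * n) *ᵥ charTensor z (fun i => (z ^ k) ^ (i : ℕ)) =
      charTensor z (fun i => (z ^ k) ^ (i : ℕ)) := by
  have hper (j : ℕ) : waveSign z (k + (n + j)) = waveSign z (k + j) := by
    simp only [waveSign, pow_add, hz, one_mul]
  have hsq (j : ℕ) : waveSign z j * waveSign z j = 1 := by
    unfold waveSign; split_ifs <;> norm_num
  rw [evolU_pow_mulVec_wave hz, two_mul, Finset.prod_range_add]
  simp only [hper, ← Finset.prod_mul_distrib, hsq, Finset.prod_const_one, one_smul, pow_add, hz,
    mul_one]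

lemma evolU_pow_two_mul_mulVec_charTensor_single {n : ℕ} [NeZero n] {z : ℂ} (hz : z ^ n = 1)
    (j : Fin n) :
    evolU n ^ (2 * n) *ᵥ charTensor z (Pi.single j 1) = charTensor z (Pi.single j 1) := by
  have hn : (n : ℂ) ≠ 0 := NeZero.ne _
  have hz0 : z ≠ 0 := by rintro rfl; simp [NeZero.ne n] at hz
  let s : Finset (Fin n) := {i | z ^ (i : ℕ) = z ^ (j : ℕ)}
  have hs : (s.card : ℂ) ≠ 0 := by
    simpa using Finset.ne_empty_of_mem (show j ∈ s by simp [s])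
  let u : Fin n → ℂ := fun i => if z ^ (i : ℕ) = z ^ (j : ℕ) then 1 else 0
  let v : Fin n → ℂ := Pi.single j 1 - (s.card : ℂ)⁻¹ • u
  have hv (k : ℕ) : ∑ i : Fin n, z ^ (k * i : ℕ) * v i = 0 := by
    have h1 : ∑ i : Fin n, z ^ (k * i : ℕ) * u i = s.card * z ^ (k * j : ℕ) := by
      simp only [u, mul_ite, mul_one, mul_zero, ← Finset.sum_filter]
      rw [Finset.sum_congr rfl (g := fun _ => z ^ (k * j : ℕ)), Finset.sum_const, nsmul_eq_mul]
      intro i hi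
      rw [mul_comm, pow_mul, (Finset.mem_filter.mp hi).2, ← pow_mul, mul_comm]
    have h2 : ∑ i : Fin n, z ^ (k * i : ℕ) * (Pi.single j 1 : Fin n → ℂ) i = z ^ (k * j : ℕ) := by
      simp [Pi.single_apply]
    simp only [v, Pi.sub_apply, Pi.smul_apply, smul_eq_mul, mul_sub, Finset.sum_sub_distrib,
      mul_left_comm _ (s.card : ℂ)⁻¹, ← Finset.mul_sum, h1, h2]
    field_simp
    ring
  have hV : evolU n ^ (2 * n) *ᵥ charTensor z v = charTensor z v := by
    rw [evolU_pow_mulVec_of_orthogonal hz hv]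
    congr 1
    ext i
    rw [mul_comm 2 n, mul_assoc, pow_mul z, hz]
    simp
  have hu : charTensor z u = ∑ k : Fin n,
      ((n : ℂ)⁻¹ * (z⁻¹ ^ (j : ℕ)) ^ (k : ℕ)) •
        charTensor z (fun i => (z ^ (k : ℕ)) ^ (i : ℕ)) := by
    ext ⟨r, i⟩
    have hw := inv_pow_mul_pow_pow_eq_one hz j i
    have h1 : z⁻¹ ^ (j : ℕ) * z ^ (i : ℕ) = 1 ↔ z ^ (i : ℕ) = z ^ (j : ℕ) := by
      rw [inv_pow, inv_mul_eq_one₀ (pow_ne_zero _ hz0), eq_comm]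
    have h2 := sum_pow_val hw
    simp only [h1] at h2
    have h3 : u i = (n : ℂ)⁻¹ * ∑ k : Fin n, (z⁻¹ ^ (j : ℕ) * z ^ (i : ℕ)) ^ (k : ℕ) := by
      rw [h2]; simp [u, hn]
    simp only [charTensor, Finset.sum_apply, Pi.smul_apply, smul_eq_mul, h3, Finset.mul_sum]
    refine Finset.sum_congr rfl fun k _ => ?_
    rw [mul_pow, ← pow_mul z i k, ← pow_mul z k i, mul_comm (i : ℕ)]
    ring
  have hU : evolU n ^ (2 * n) *ᵥ charTensor z u = charTensor z u := by
    rw [hu, mulVec_sum]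
    exact Finset.sum_congr rfl fun k _ => by
      rw [mulVec_smul, evolU_pow_two_mul_mulVec_wave hz]
  have hdecomp : charTensor z (Pi.single j 1) =
      charTensor z v + (s.card : ℂ)⁻¹ • charTensor z u := by
    ext p
    simp only [charTensor, v, Pi.add_apply, Pi.sub_apply, Pi.smul_apply, smul_eq_mul]
    ring
  rw [hdecomp, mulVec_add, mulVec_smul, hV, hU]

lemma evolU_pow_two_mul {n : ℕ} [NeZero n] : evolU n ^ (2 * n) = 1 := by
  have hn : (n : ℂ) ≠ 0 := NeZero.ne _
  obtain ⟨ω, hω⟩ : ∃ ω : ℂ, IsPrimitiveRoot ω n := ⟨_, Complex.isPrimitiveRoot_exp n (NeZero.ne n)⟩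
  refine Matrix.ext_of_mulVec_single fun ⟨r, j⟩ => ?_
  have hω0 : ω ≠ 0 := hω.ne_zero (NeZero.ne n)
  have hdecomp : (Pi.single (r, j) 1 : Fin n × Fin n → ℂ) = ∑ a : Fin n,
      ((n : ℂ)⁻¹ * (ω⁻¹ ^ (r : ℕ)) ^ (a : ℕ)) • charTensor (ω ^ (a : ℕ)) (Pi.single j 1) := by
    ext ⟨q, i⟩
    have hw := inv_pow_mul_pow_pow_eq_one hω.pow_eq_one r q
    have h1 : ω⁻¹ ^ (r : ℕ) * ω ^ (q : ℕ) = 1 ↔ q = r := by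
      rw [inv_pow, inv_mul_eq_one₀ (pow_ne_zero _ hω0), eq_comm, Fin.ext_iff]
      exact ⟨hω.pow_inj q.2 r.2, fun h => by rw [h]⟩
    have h2 := sum_pow_val hw
    simp only [h1] at h2
    have h3 : (Pi.single (r, j) 1 : Fin n × Fin n → ℂ) (q, i) =
        (n : ℂ)⁻¹ * (∑ a : Fin n, (ω⁻¹ ^ (r : ℕ) * ω ^ (q : ℕ)) ^ (a : ℕ)) *
          (Pi.single j 1 : Fin n → ℂ) i := by
      rw [h2]
      by_cases hq : q = r <;> by_cases hi : i = j <;> simp [hn, hq, hi]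
    simp only [charTensor, Finset.sum_apply, Pi.smul_apply, smul_eq_mul, h3, Finset.mul_sum,
      Finset.sum_mul]
    refine Finset.sum_congr rfl fun a _ => ?_
    rw [mul_pow, ← pow_mul ω q a, ← pow_mul ω a q, mul_comm (q : ℕ)]
    ring
  rw [one_mulVec, hdecomp, mulVec_sum]
  refine Finset.sum_congr rfl fun a _ => ?_
  rw [mulVec_smul, evolU_pow_two_mul_mulVec_charTensor_single]
  rw [← pow_mul, mul_comm, pow_mul, hω.pow_eq_one, one_pow]

lemma even_of_evolU_pow_eq_one {n m : ℕ} (hn : 2 ≤ n) (h : evolU n ^ m = 1) : Even m := by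
  obtain ⟨n, rfl⟩ := Nat.exists_eq_add_of_le' hn
  have hv (k : ℕ) : ∑ i : Fin (n + 2), (1 : ℂ) ^ (k * i : ℕ) *
      (Pi.single 0 1 - Pi.single 1 1 : Fin (n + 2) → ℂ) i = 0 := by
    simp [Finset.sum_sub_distrib]
  have key := congrFun (evolU_pow_mulVec_of_orthogonal (one_pow _) hv m) (0, 0)
  rw [h, one_mulVec] at key
  simp only [charTensor, one_pow, one_mul, Pi.sub_apply, Pi.single_apply] at key
  norm_num at key
  by_contra ho
  rw [(Nat.not_even_iff_odd.mp ho).neg_one_pow] at key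
  norm_num at key

lemma prod_waveSign_of_evolU_pow_eq_one {n m : ℕ} (hn : 2 ≤ n) {ω : ℂ} (hω : IsPrimitiveRoot ω n)
    (h : evolU n ^ m = 1) : ∏ j ∈ Finset.range m, waveSign ω j = 1 ∧ n ∣ m := by
  obtain ⟨n, rfl⟩ := Nat.exists_eq_add_of_le' hn
  have key := evolU_pow_mulVec_wave hω.pow_eq_one 0 m
  rw [h, one_mulVec] at key
  have h0 := congrFun key (0, 0)
  have h1 := congrFun key (0, 1)
  simp only [charTensor, Pi.smul_apply, smul_eq_mul, zero_add, Fin.val_zero, Fin.val_one, pow_zero,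
    pow_one, mul_one] at h0 h1
  rw [← h0, one_mul, one_mul] at h1
  exact ⟨h0.symm, hω.dvd_of_pow_eq_one m h1.symm⟩

lemma prod_waveSign {n : ℕ} {ω : ℂ} (hω : IsPrimitiveRoot ω (n + 1)) :
    ∏ j ∈ Finset.range (n + 1), waveSign ω j = (-1) ^ n := by
  rw [Finset.prod_range_succ', Finset.prod_congr rfl (g := fun _ => (-1 : ℂ))]
  · simp [waveSign]
  · intro j hj
    have hj := Finset.mem_range.mp hj
    exact if_neg (hω.pow_ne_one_of_pos_of_lt (by omega) (by omega))

/-- `2n` is the smallest positive integer `m` with `U^m = I_{n²}`: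
the Grover walk on the complete graph with self-loops is periodic with period `2n`. -/
theorem period_U (n : ℕ) (hn : 2 ≤ n) :
    evolU n ^ (2 * n) = 1 ∧ ∀ m : ℕ, 0 < m → m < 2 * n → evolU n ^ m ≠ 1 := by
  have : NeZero n := ⟨by omega⟩
  refine ⟨evolU_pow_two_mul, fun m hm hlt h => ?_⟩
  have hω := Complex.isPrimitiveRoot_exp n (NeZero.ne n)
  obtain ⟨hprod, c, rfl⟩ := prod_waveSign_of_evolU_pow_eq_one hn hω h
  have hev := even_of_evolU_pow_eq_one hn h
  obtain rfl : c = 1 := by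
    have : 0 < c := Nat.pos_of_mul_pos_left hm
    have : c < 2 := by nlinarith
    omega
  obtain ⟨k, rfl⟩ := Nat.exists_eq_add_of_le' (show 1 ≤ n by omega)
  rw [mul_one] at hprod hev
  rw [prod_waveSign hω, Odd.neg_one_pow (by grind)] at hprod
  norm_num at hprod
end
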